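/- Let D, t₀ ∈ ℝ. There is no function l : ℝ → ℝ with l(t₀)² > D² such that for every t ∈ ℝ, l has derivative l(t)² − D² at t. In other words, every solution of l' = l² − D² that at some time exceeds D in absolute value blows up in finite (forward or backward) time and cannot be defined on all of ℝ. -/

import Mathlib

theorem le_of_riccati {D t₀ : ℝ} {l : ℝ → ℝ} (h₀ : D ^ 2 < l t₀ ^ 2)
    (hl : ∀ t : ℝ, HasDerivAt l (l t ^ 2 - D ^ 2) t) {t : ℝ} (ht : t₀ ≤ t) : l t₀ ≤ l t := by
  refine image_le_of_deriv_right_lt_deriv_boundary (f := fun _ => l t₀) (f' := fun _ => 0)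
    (a := t₀) (b := t) continuousOn_const (fun x _ => hasDerivWithinAt_const x _ _) le_rfl hl
    (fun x _ hx => ?_) ⟨ht, le_rfl⟩
  rw [← hx]
  linarith

theorem riccati_not_global_of_pos {D t₀ : ℝ} {l : ℝ → ℝ} (hpos : 0 < l t₀)
    (h₀ : D ^ 2 < l t₀ ^ 2) (hl : ∀ t : ℝ, HasDerivAt l (l t ^ 2 - D ^ 2) t) : False := by
  obtain ⟨k, hk⟩ : ∃ k, k = (l t₀ ^ 2 - D ^ 2) / l t₀ ^ 2 := ⟨_, rfl⟩
  have hk0 : 0 < k := hk ▸ div_pos (by linarith) (by positivity)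
  have hk1 : k * l t₀ ^ 2 = l t₀ ^ 2 - D ^ 2 := by rw [hk]; field_simp
  have hge {t : ℝ} (ht : t₀ ≤ t) : l t₀ ≤ l t := le_of_riccati h₀ hl ht
  have hd {t : ℝ} (ht : t₀ ≤ t) :
      HasDerivAt (fun s => (l s)⁻¹ + k * s) (-(l t ^ 2 - D ^ 2) / l t ^ 2 + k) t := by
    simpa using ((hl t).fun_inv (hpos.trans_le (hge ht)).ne').fun_add ((hasDerivAt_id t).const_mul k)
  have hanti : AntitoneOn (fun s => (l s)⁻¹ + k * s) (Set.Ici t₀) := by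
    refine antitoneOn_of_deriv_nonpos (convex_Ici t₀)
      (fun t ht => (hd ht).continuousAt.continuousWithinAt)
      (fun t ht => (hd (interior_subset ht)).differentiableAt.differentiableWithinAt)
      fun t ht => ?_
    have ht' : t₀ ≤ t := interior_subset ht
    have hlt : 0 < l t := hpos.trans_le (hge ht')
    have hsq : l t₀ ^ 2 ≤ l t ^ 2 := pow_le_pow_left₀ hpos.le (hge ht') 2
    have hk2 : k ≤ 1 := by
      rw [hk, div_le_one (by positivity)]
      linarith [sq_nonneg D]
    rw [(hd ht').deriv, neg_div, neg_add_nonpos_iff, le_div_iff₀ (by positivity)]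
    nlinarith
  have hT : t₀ ≤ t₀ + (l t₀)⁻¹ / k := le_add_of_nonneg_right (by positivity)
  have h := hanti Set.self_mem_Ici hT hT
  have hinv : 0 < (l (t₀ + (l t₀)⁻¹ / k))⁻¹ := inv_pos.2 (hpos.trans_le (hge hT))
  have hmul : k * (t₀ + (l t₀)⁻¹ / k) = k * t₀ + (l t₀)⁻¹ := by field_simp
  simp only [hmul] at h
  linarith

/-- Case 3 (C = −D² < 0) of Proposition 4.2: every solution of l' = l² − D² that at some
time exceeds D in absolute value blows up in finite time; no global solution on ℝ exists. -/
theorem riccati_neg_no_global_solution (D t₀ : ℝ) :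
    ¬ ∃ l : ℝ → ℝ, l t₀ ^ 2 > D ^ 2 ∧ ∀ t : ℝ, HasDerivAt l (l t ^ 2 - D ^ 2) t := by
  rintro ⟨l, h₀, hl⟩
  rcases lt_trichotomy (l t₀) 0 with hneg | hzero | hpos
  · have hrev (t : ℝ) : HasDerivAt (fun s => -l (-s)) ((-l (-t)) ^ 2 - D ^ 2) t := by
      simpa [Function.comp_def] using ((hl (-t)).scomp t (hasDerivAt_neg t)).fun_neg
    exact riccati_not_global_of_pos (t₀ := -t₀) (by simpa using hneg) (by simpa using h₀) hrev
  · rw [hzero] at h₀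
    nlinarith [sq_nonneg D]
  · exact riccati_not_global_of_pos hpos h₀ hl
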